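/- Under the hypotheses of the convergence theorem (X, Y real normed spaces where every bounded sequence in X has a weakly convergent subsequence; D ⊆ X nonempty and weakly sequentially closed; F : D → Y; R : X → [0,∞] weakly sequentially lsc and coercive; 𝒟 : Y × Y → [0,∞] with 𝒟(y₀,y₁) = 0 ⟺ y₀ = y₁ and such that x_n ⇀ x̄ in D together with 𝒟(y_n,y) → 0 and 𝒟(y,y_n) → 0 implies 𝒟(F(x̄),y) ≤ liminf_n 𝒟(F(x_n),y_n); x ∈ D with y := F(x), R(x) < ∞; δ_k > 0, δ_k → 0; 𝒟(y_k,y) ≤ δ_k and 𝒟(y,y_k) ≤ δ_k; α(δ) → 0 and δ/α(δ) → 0 as δ → 0; x_k a minimizer of T_{α(δ_k);y_k} over D), assume additionally that there is a unique R-minimizing solution x⁺ of F(x) = y. Then the whole sequence (x_k) converges weakly to x⁺. -/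

import Mathlib

open Filter Topology ENNReal

/-- Weak sequential convergence in a real normed space. -/
def WConv {E : Type*} [NormedAddCommGroup E] [NormedSpace ℝ E] (u : ℕ → E) (x : E) : Prop :=
  ∀ f : E →L[ℝ] ℝ, Filter.Tendsto (fun n => f (u n)) Filter.atTop (nhds (f x))

/-- A sequence along which a coercive extended-valued functional is bounded by a finite constant
is norm bounded. -/
theorem exists_norm_le_of_coercive {E : Type*} [NormedAddCommGroup E] {R : E → ℝ≥0∞}
    (hR : ∀ u : ℕ → E, Tendsto (fun n => ‖u n‖) atTop atTop →
      Tendsto (fun n => R (u n)) atTop (𝓝 ⊤))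
    {v : ℕ → E} {C : ℝ≥0∞} (hC : C < ⊤) (hv : ∀ n, R (v n) ≤ C) :
    ∃ M : ℝ, ∀ n, ‖v n‖ ≤ M := by
  by_contra! h
  choose k hk using fun n : ℕ => h n
  have hnorm : Tendsto (fun n => ‖v (k n)‖) atTop atTop :=
    tendsto_atTop_mono (fun n => (hk n).le) tendsto_natCast_atTop_atTop
  exact hC.not_ge (le_of_tendsto' (hR _ hnorm) fun n => hv (k n))

/-- If the R-minimizing solution is unique, the whole sequence of NETT regularized
solutions converges weakly to it. -/
theorem statement3 {X Y : Type*} [NormedAddCommGroup X] [NormedSpace ℝ X]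
    [NormedAddCommGroup Y] [NormedSpace ℝ Y]
    -- every bounded sequence in X has a weakly convergent subsequence
    (hrefl : ∀ u : ℕ → X, (∃ M : ℝ, ∀ n, ‖u n‖ ≤ M) →
      ∃ φ : ℕ → ℕ, StrictMono φ ∧ ∃ xb : X, WConv (fun n => u (φ n)) xb)
    (D : Set X) (hD : D.Nonempty)
    -- D is weakly sequentially closed
    (hDcl : ∀ (u : ℕ → X) (xb : X), (∀ n, u n ∈ D) → WConv u xb → xb ∈ D)
    (F : X → Y)
    (R : X → ℝ≥0∞)
    -- R is weakly sequentially lower semicontinuous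
    (hRlsc : ∀ (u : ℕ → X) (xb : X), WConv u xb →
      R xb ≤ Filter.liminf (fun n => R (u n)) Filter.atTop)
    -- R is coercive
    (hRcoer : ∀ u : ℕ → X, Tendsto (fun n => ‖u n‖) atTop atTop →
      Tendsto (fun n => R (u n)) atTop (𝓝 (⊤ : ℝ≥0∞)))
    (𝒟 : Y → Y → ℝ≥0∞)
    (h𝒟eq : ∀ y₀ y₁ : Y, 𝒟 y₀ y₁ = 0 ↔ y₀ = y₁)
    (x : X) (hxD : x ∈ D) (y : Y) (hy : y = F x) (hRx : R x < ⊤)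
    -- joint sequential lower semicontinuity of the data term
    (hjoint : ∀ (u : ℕ → X) (xb : X) (ys : ℕ → Y), (∀ n, u n ∈ D) → xb ∈ D →
      WConv u xb → Tendsto (fun n => 𝒟 (ys n) y) atTop (𝓝 0) →
      Tendsto (fun n => 𝒟 y (ys n)) atTop (𝓝 0) →
      𝒟 (F xb) y ≤ Filter.liminf (fun n => 𝒟 (F (u n)) (ys n)) Filter.atTop)
    -- noise levels
    (δ : ℕ → ℝ) (hδpos : ∀ k, 0 < δ k) (hδ0 : Tendsto δ atTop (𝓝 0))
    -- noisy data
    (yk : ℕ → Y) (hyk1 : ∀ k, 𝒟 (yk k) y ≤ ENNReal.ofReal (δ k))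
    (hyk2 : ∀ k, 𝒟 y (yk k) ≤ ENNReal.ofReal (δ k))
    -- parameter choice rule
    (α : ℝ → ℝ) (hαpos : ∀ d : ℝ, 0 < d → 0 < α d)
    (hα0 : Tendsto α (𝓝[>] (0:ℝ)) (𝓝 0))
    (hδα : Tendsto (fun d => d / α d) (𝓝[>] (0:ℝ)) (𝓝 0))
    -- minimizers of the Tikhonov functional for the noisy data
    (xk : ℕ → X) (hxkD : ∀ k, xk k ∈ D)
    (hmin : ∀ k, ∀ z ∈ D,
      𝒟 (F (xk k)) (yk k) + ENNReal.ofReal (α (δ k)) * R (xk k) ≤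
        𝒟 (F z) (yk k) + ENNReal.ofReal (α (δ k)) * R z)
    -- there is a unique R-minimizing solution x⁺
    (xp : X) (hxpD : xp ∈ D) (hxpF : F xp = y)
    (hxpmin : ∀ z ∈ D, F z = y → R xp ≤ R z)
    (huniq : ∀ z ∈ D, F z = y → (∀ w ∈ D, F w = y → R z ≤ R w) → z = xp) :
    WConv xk xp := by
  have hRxp : R xp < ⊤ := (hxpmin x hxD hy.symm).trans_lt hRx
  have hδ0' : Tendsto δ atTop (𝓝[>] (0 : ℝ)) :=
    tendsto_nhdsWithin_iff.2 ⟨hδ0, Eventually.of_forall hδpos⟩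
  have hα : Tendsto (fun k => ENNReal.ofReal (α (δ k))) atTop (𝓝 0) := by
    simpa using ENNReal.tendsto_ofReal (hα0.comp hδ0')
  have hδ : Tendsto (fun k => ENNReal.ofReal (δ k)) atTop (𝓝 0) := by
    simpa using ENNReal.tendsto_ofReal hδ0
  have hq : Tendsto (fun k => δ k / α (δ k)) atTop (𝓝 0) := hδα.comp hδ0'
  have hq' : Tendsto (fun k => ENNReal.ofReal (δ k / α (δ k))) atTop (𝓝 0) := by
    simpa using ENNReal.tendsto_ofReal hq
  have hT : ∀ k, 𝒟 (F (xk k)) (yk k) + ENNReal.ofReal (α (δ k)) * R (xk k) ≤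
      ENNReal.ofReal (δ k) + ENNReal.ofReal (α (δ k)) * R xp := fun k =>
    (hmin k xp hxpD).trans (by rw [hxpF]; gcongr; exact hyk2 k)
  have hdata : Tendsto (fun k => 𝒟 (F (xk k)) (yk k)) atTop (𝓝 0) := by
    have hlim : Tendsto (fun k => ENNReal.ofReal (δ k) + ENNReal.ofReal (α (δ k)) * R xp)
        atTop (𝓝 0) := by
      simpa using hδ.add (ENNReal.Tendsto.mul_const hα (Or.inr hRxp.ne))
    exact tendsto_of_tendsto_of_tendsto_of_le_of_le tendsto_const_nhds hlim
      (fun _ => zero_le) (fun k => le_self_add.trans (hT k))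
  have hRk : ∀ k, R (xk k) ≤ ENNReal.ofReal (δ k / α (δ k)) + R xp := by
    intro k
    have hpos := hαpos _ (hδpos k)
    have hne : ENNReal.ofReal (α (δ k)) ≠ 0 := (ENNReal.ofReal_pos.2 hpos).ne'
    have hmul := le_add_self.trans (hT k)
    rw [← ENNReal.mul_le_mul_iff_right hne ENNReal.ofReal_ne_top, mul_add,
      ← ENNReal.ofReal_mul hpos.le, mul_div_cancel₀ _ hpos.ne']
    exact hmul
  obtain ⟨B, hB⟩ := hq.bddAbove_range
  have hbound : ∀ k, R (xk k) ≤ ENNReal.ofReal B + R xp := fun k =>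
    (hRk k).trans (by gcongr; exact hB ⟨k, rfl⟩)
  have hRlim : Tendsto (fun k => ENNReal.ofReal (δ k / α (δ k)) + R xp) atTop (𝓝 (R xp)) := by
    simpa using hq'.add_const (R xp)
  intro f
  refine tendsto_of_subseq_tendsto fun ns hns => ?_
  obtain ⟨φ, hφ, xb, hxb⟩ := hrefl (fun n => xk (ns n)) <|
    exists_norm_le_of_coercive hRcoer (ENNReal.add_lt_top.2 ⟨ENNReal.ofReal_lt_top, hRxp⟩)
      fun n => hbound (ns n)
  have hσ : Tendsto (fun n => ns (φ n)) atTop atTop := hns.comp hφ.tendsto_atTop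
  have hxbD : xb ∈ D := hDcl _ xb (fun n => hxkD _) hxb
  have hyk1' : Tendsto (fun k => 𝒟 (yk k) y) atTop (𝓝 0) :=
    tendsto_of_tendsto_of_tendsto_of_le_of_le tendsto_const_nhds hδ (fun _ => zero_le) hyk1
  have hyk2' : Tendsto (fun k => 𝒟 y (yk k)) atTop (𝓝 0) :=
    tendsto_of_tendsto_of_tendsto_of_le_of_le tendsto_const_nhds hδ (fun _ => zero_le) hyk2
  have hxbF : F xb = y := by
    have hle := hjoint _ xb (fun n => yk (ns (φ n))) (fun n => hxkD _) hxbD hxb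
      (hyk1'.comp hσ) (hyk2'.comp hσ)
    exact (h𝒟eq _ _).1 (nonpos_iff_eq_zero.1 (hle.trans_eq (hdata.comp hσ).liminf_eq))
  have hxbR : R xb ≤ R xp := calc
    R xb ≤ liminf (fun n => R (xk (ns (φ n)))) atTop := hRlsc _ xb hxb
    _ ≤ liminf (fun n => ENNReal.ofReal (δ (ns (φ n)) / α (δ (ns (φ n)))) + R xp) atTop :=
      liminf_le_liminf (Eventually.of_forall fun n => hRk _)
    _ = R xp := (hRlim.comp hσ).liminf_eq
  obtain rfl := huniq xb hxbD hxbF fun w hw hFw => hxbR.trans (hxpmin w hw hFw)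
  exact ⟨φ, hxb f⟩
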